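/- Let m ≥ 1 and let K ⊆ ℝ^m be a strictly convex body. Then there exists a continuous map f : ℝP^m → S^m with the following property: for every integer k ≥ 2, if f admits a k-multiplicity, then there exist k pairwise distinct lines L_1, …, L_k in ℝ^m, each an affine diameter of K in some direction, such that L_1 ∩ ⋯ ∩ L_k ∩ int(K) ≠ ∅. -/

import Mathlib

/-- The projectivization of a topological vector space carries the quotient topology
coming from the nonzero vectors. -/
instance projectivizationTopology (K V : Type*) [DivisionRing K] [AddCommGroup V]
    [Module K V] [TopologicalSpace V] : TopologicalSpace (Projectivization K V) :=
  inferInstanceAs (TopologicalSpace (Quotient (projectivizationSetoid K V)))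

/-- `L` is a line in `ℝ^m` parallel to the (nonzero) vector `w`. -/
def IsLineParallel {m : ℕ} (w : EuclideanSpace ℝ (Fin m))
    (L : Set (EuclideanSpace ℝ (Fin m))) : Prop :=
  ∃ v : EuclideanSpace ℝ (Fin m), L = {p | ∃ t : ℝ, p = v + t • w}

/-- `L` is an affine diameter of `K` in direction `w`: a line parallel to `w` whose
chord `K ∩ L` has maximal length among all lines parallel to `w`. -/
def IsAffineDiameter {m : ℕ} (K : Set (EuclideanSpace ℝ (Fin m)))
    (w : EuclideanSpace ℝ (Fin m)) (L : Set (EuclideanSpace ℝ (Fin m))) : Prop :=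
  IsLineParallel w L ∧
    ∀ L', IsLineParallel w L' → Metric.diam (K ∩ L') ≤ Metric.diam (K ∩ L)

section MaximalChords

open Set Metric Topology Bornology
open scoped Pointwise

variable {E : Type*} [NormedAddCommGroup E] {K : Set E}

lemma neg_mem_sub_self : ∀ x ∈ K - K, -x ∈ K - K := by
  rintro _ ⟨x, hx, y, hy, rfl⟩
  exact ⟨y, hy, x, hx, (neg_sub x y).symm⟩

lemma sub_self_mem_nhds_zero (hint : (interior K).Nonempty) : K - K ∈ 𝓝 (0 : E) := by
  obtain ⟨x, hx⟩ := hint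
  refine Filter.mem_of_superset (isOpen_interior.sub_right.mem_nhds ⟨x, hx, x, hx, sub_self x⟩)
    (sub_subset_sub (interior_subset (s := K)) (interior_subset (s := K)))

variable [NormedSpace ℝ E] {u a b a' b' : E}

/-- `a` and `b` are boundary points of `K` whose difference is the vector of maximal length
in `K - K` that is a positive multiple of `u`; for `u = 0` there is no condition on `b - a`. -/
def IsMaximalChord (K : Set E) (u a b : E) : Prop :=
  a ∈ frontier K ∧ b ∈ frontier K ∧ gauge (K - K) u • (b - a) = u

lemma gauge_sub_self_smul (r : ℝ) (x : E) :
    gauge (K - K) (r • x) = |r| * gauge (K - K) x := by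
  rcases abs_choice r with h | h
  · rw [h, ← smul_eq_mul, gauge_smul_of_nonneg (abs_eq_self.1 h)]
  · rw [h, ← smul_eq_mul, ← gauge_smul_of_nonneg (neg_nonneg.2 (abs_eq_neg_self.1 h)), neg_smul,
      gauge_neg neg_mem_sub_self]

lemma gauge_sub_self_pos (hK : IsCompact K) (hint : (interior K).Nonempty) (hu : u ≠ 0) :
    0 < gauge (K - K) u :=
  (gauge_pos (absorbent_nhds_zero (sub_self_mem_nhds_zero hint))
    (NormedSpace.isVonNBounded_of_isBounded ℝ (hK.isBounded.sub hK.isBounded))).2 hu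

lemma gauge_sub_lt_one_of_mem_interior (ha : a ∈ interior K) (hb : b ∈ K) :
    gauge (K - K) (b - a) < 1 :=
  interior_subset_gauge_lt_one _ <|
    interior_maximal (sub_subset_sub_left interior_subset) isOpen_interior.sub_left
      ⟨b, hb, a, ha, rfl⟩

lemma gauge_sub_lt_one_of_mem_interior' (ha : a ∈ K) (hb : b ∈ interior K) :
    gauge (K - K) (b - a) < 1 := by
  rw [← neg_sub a b, gauge_neg neg_mem_sub_self]
  exact gauge_sub_lt_one_of_mem_interior hb ha

namespace IsMaximalChord

lemma left_mem (h : IsMaximalChord K u a b) (hK : IsCompact K) : a ∈ K :=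
  hK.isClosed.frontier_subset h.1

lemma right_mem (h : IsMaximalChord K u a b) (hK : IsCompact K) : b ∈ K :=
  hK.isClosed.frontier_subset h.2.1

lemma smul_of_pos (h : IsMaximalChord K u a b) {r : ℝ} (hr : 0 < r) :
    IsMaximalChord K (r • u) a b :=
  ⟨h.1, h.2.1, by rw [gauge_sub_self_smul, abs_of_pos hr, mul_smul, h.2.2]⟩

lemma smul_of_neg (h : IsMaximalChord K u a b) {r : ℝ} (hr : r < 0) :
    IsMaximalChord K (r • u) b a :=
  ⟨h.2.1, h.1, by
    rw [gauge_sub_self_smul, abs_of_neg hr, mul_smul, ← neg_sub b a, smul_neg, h.2.2, smul_neg,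
      neg_smul, neg_neg]⟩

lemma gauge_sub (h : IsMaximalChord K u a b) (hK : IsCompact K) (hint : (interior K).Nonempty)
    (hu : u ≠ 0) : gauge (K - K) (b - a) = 1 := by
  have hpos := gauge_sub_self_pos hK hint hu
  have := congrArg (gauge (K - K)) h.2.2
  rw [gauge_sub_self_smul, abs_of_pos hpos] at this
  exact mul_left_cancel₀ hpos.ne' (this.trans (mul_one _).symm)

lemma ne (h : IsMaximalChord K u a b) (hu : u ≠ 0) : a ≠ b := by
  rintro rfl
  exact hu (by simpa using h.2.2.symm)

lemma eq_and_eq (h : IsMaximalChord K u a b) (h' : IsMaximalChord K u a' b') (hK : IsCompact K)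
    (hint : (interior K).Nonempty) (hstrict : StrictConvex ℝ K) (hu : u ≠ 0) :
    a = a' ∧ b = b' := by
  have hsub : b - a = b' - a' :=
    smul_right_injective E (gauge_sub_self_pos hK hint hu).ne' (h.2.2.trans h'.2.2.symm)
  have haa : a = a' := by
    by_contra hne
    have hmid : (2⁻¹ : ℝ) • a + (2⁻¹ : ℝ) • a' ∈ interior K :=
      hstrict (h.left_mem hK) (h'.left_mem hK) hne (by norm_num) (by norm_num) (by norm_num)
    have hmid' : (2⁻¹ : ℝ) • b + (2⁻¹ : ℝ) • b' ∈ K :=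
      hstrict.convex (h.right_mem hK) (h'.right_mem hK) (by norm_num) (by norm_num) (by norm_num)
    refine (gauge_sub_lt_one_of_mem_interior hmid hmid').ne ?_
    rw [← h.gauge_sub hK hint hu]
    congr 1
    have : (2⁻¹ : ℝ) • b + (2⁻¹ : ℝ) • b' - ((2⁻¹ : ℝ) • a + (2⁻¹ : ℝ) • a')
        = (2⁻¹ : ℝ) • (b - a) + (2⁻¹ : ℝ) • (b' - a') := by module
    rw [this, ← hsub]
    module
  exact ⟨haa, by rw [haa] at hsub; exact sub_left_injective hsub⟩

lemma dist_le (h : IsMaximalChord K u a b) {x y : E} (hx : x ∈ K) (hy : y ∈ K) {t : ℝ}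
    (ht : x - y = t • u) : dist x y ≤ dist a b := by
  have hle : gauge (K - K) (t • u) ≤ 1 := gauge_le_one_of_mem (ht ▸ sub_mem_sub hx hy)
  rw [gauge_sub_self_smul] at hle
  rw [dist_eq_norm, dist_comm, dist_eq_norm, ht]
  nth_rw 1 [← h.2.2]
  rw [smul_smul, norm_smul, Real.norm_eq_abs, abs_mul, abs_of_nonneg (gauge_nonneg u)]
  exact mul_le_of_le_one_left (norm_nonneg _) hle

end IsMaximalChord

lemma exists_isMaximalChord_of_ne_zero (hK : IsCompact K) (hconv : Convex ℝ K)
    (hint : (interior K).Nonempty) (hu : u ≠ 0) : ∃ a b, IsMaximalChord K u a b := by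
  have hpos := gauge_sub_self_pos hK hint hu
  have hnhds := sub_self_mem_nhds_zero hint
  have hone : gauge (K - K) ((gauge (K - K) u)⁻¹ • u) = 1 := by
    rw [gauge_sub_self_smul, abs_of_pos (inv_pos.2 hpos), inv_mul_cancel₀ hpos.ne']
  have hclosed : IsClosed (K - K) := by
    rw [sub_eq_add_neg]
    exact (hK.add hK.neg).isClosed
  obtain ⟨b, hb, a, ha, hab⟩ : (gauge (K - K) u)⁻¹ • u ∈ K - K :=
    hclosed.closure_subset
      ((gauge_le_one_iff_mem_closure (hconv.sub hconv) hnhds).1 hone.le)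
  simp only at hab
  rw [← hab] at hone
  refine ⟨a, b, ?_, ?_, ?_⟩
  · rw [hK.isClosed.frontier_eq]
    exact ⟨ha, fun h ↦ (gauge_sub_lt_one_of_mem_interior h hb).ne hone⟩
  · rw [hK.isClosed.frontier_eq]
    exact ⟨hb, fun h ↦ (gauge_sub_lt_one_of_mem_interior' ha h).ne hone⟩
  · rw [hab, smul_inv_smul₀ hpos.ne']

lemma exists_isMaximalChord [Nontrivial E] (hK : IsCompact K) (hconv : Convex ℝ K)
    (hint : (interior K).Nonempty) (u : E) : ∃ a b, IsMaximalChord K u a b := by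
  rcases eq_or_ne u 0 with rfl | hu
  · obtain ⟨w, hw⟩ := exists_ne (0 : E)
    obtain ⟨a, b, h⟩ := exists_isMaximalChord_of_ne_zero hK hconv hint hw
    exact ⟨a, a, h.1, h.1, by simp⟩
  · exact exists_isMaximalChord_of_ne_zero hK hconv hint hu

end MaximalChords

section ChordPoint

open Set Metric Topology
open scoped Pointwise

variable {m : ℕ}

/-- The vector of all coordinates but the first. -/
noncomputable def euclideanTail (v : EuclideanSpace ℝ (Fin (m + 1))) : EuclideanSpace ℝ (Fin m) :=
  WithLp.toLp 2 fun i ↦ v i.succ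

/-- The vector with first coordinate `s` and remaining coordinates `y`. -/
noncomputable def euclideanCons (s : ℝ) (y : EuclideanSpace ℝ (Fin m)) :
    EuclideanSpace ℝ (Fin (m + 1)) :=
  WithLp.toLp 2 (Fin.cons s y)

@[simp] lemma euclideanTail_apply (v : EuclideanSpace ℝ (Fin (m + 1))) (i : Fin m) :
    euclideanTail v i = v i.succ := rfl

@[simp] lemma euclideanCons_zero (s : ℝ) (y : EuclideanSpace ℝ (Fin m)) :
    euclideanCons s y 0 = s := rfl

@[simp] lemma euclideanTail_cons (s : ℝ) (y : EuclideanSpace ℝ (Fin m)) :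
    euclideanTail (euclideanCons s y) = y := rfl

lemma euclideanTail_smul (r : ℝ) (v : EuclideanSpace ℝ (Fin (m + 1))) :
    euclideanTail (r • v) = r • euclideanTail v := rfl

lemma euclidean_ext {v w : EuclideanSpace ℝ (Fin (m + 1))} (h0 : v 0 = w 0)
    (h : euclideanTail v = euclideanTail w) : v = w := by
  ext i
  refine Fin.cases h0 (fun j ↦ ?_) i
  exact congrArg (fun z : EuclideanSpace ℝ (Fin m) ↦ z j) h

lemma norm_sq_eq_sq_add_norm_tail_sq (v : EuclideanSpace ℝ (Fin (m + 1))) :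
    ‖v‖ ^ 2 = v 0 ^ 2 + ‖euclideanTail v‖ ^ 2 := by
  simp [EuclideanSpace.norm_sq_eq, Fin.sum_univ_succ]

@[fun_prop] lemma continuous_euclideanTail :
    Continuous (euclideanTail : EuclideanSpace ℝ (Fin (m + 1)) → _) := by
  unfold euclideanTail
  fun_prop

/-- The map wrapping the closed unit ball of `ℝ^m` around the unit sphere of `ℝ^(m+1)`: it is
injective on the open ball and collapses the boundary to the point `(1, 0)`. -/
noncomputable def ballToSphere (y : EuclideanSpace ℝ (Fin m)) : EuclideanSpace ℝ (Fin (m + 1)) :=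
  euclideanCons (2 * ‖y‖ ^ 2 - 1) ((2 * √(1 - ‖y‖ ^ 2)) • y)

lemma continuous_ballToSphere :
    Continuous (ballToSphere : EuclideanSpace ℝ (Fin m) → _) := by
  refine (PiLp.continuous_toLp 2 _).comp (continuous_pi fun i ↦ ?_)
  refine Fin.cases ?_ (fun j ↦ ?_) i
  · simp only [Fin.cons_zero]
    fun_prop
  · simp only [Fin.cons_succ]
    fun_prop

lemma norm_ballToSphere {y : EuclideanSpace ℝ (Fin m)} (hy : ‖y‖ ≤ 1) : ‖ballToSphere y‖ = 1 := by
  have hnonneg : 0 ≤ 1 - ‖y‖ ^ 2 := by nlinarith [norm_nonneg y]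
  have hsq : ‖ballToSphere y‖ ^ 2 = 1 := by
    rw [norm_sq_eq_sq_add_norm_tail_sq, ballToSphere, euclideanCons_zero, euclideanTail_cons,
      norm_smul, mul_pow, Real.norm_eq_abs, sq_abs, mul_pow, Real.sq_sqrt hnonneg]
    ring
  exact (pow_eq_one_iff_of_nonneg (norm_nonneg _) two_ne_zero).1 hsq

lemma norm_eq_of_ballToSphere_eq {y z : EuclideanSpace ℝ (Fin m)}
    (h : ballToSphere y = ballToSphere z) : ‖y‖ = ‖z‖ := by
  have h0 : 2 * ‖y‖ ^ 2 - 1 = 2 * ‖z‖ ^ 2 - 1 := congrArg (fun v ↦ v 0) h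
  exact (sq_eq_sq₀ (norm_nonneg _) (norm_nonneg _)).1 (by linarith)

lemma ballToSphere_injOn : InjOn (ballToSphere (m := m)) (ball 0 1) := by
  intro y hy z hz h
  rw [mem_ball_zero_iff] at hy hz
  have hpos : 0 < 1 - ‖z‖ ^ 2 := by nlinarith [norm_nonneg z]
  have ht : (2 * √(1 - ‖y‖ ^ 2)) • y = (2 * √(1 - ‖z‖ ^ 2)) • z := congrArg euclideanTail h
  rw [norm_eq_of_ballToSphere_eq h] at ht
  exact smul_right_injective _ (by positivity) ht

lemma ballToSphere_eq_of_mem_sphere {y z : EuclideanSpace ℝ (Fin m)} (hy : y ∈ sphere 0 1)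
    (hz : z ∈ sphere 0 1) : ballToSphere y = ballToSphere z := by
  rw [mem_sphere_zero_iff_norm] at hy hz
  simp [ballToSphere, hy, hz]

/-- A convex body is wrapped around the sphere by a map which is injective on the interior and
collapses the boundary to a single point. -/
lemma exists_wrapping {K : Set (EuclideanSpace ℝ (Fin m))} (hK : IsCompact K)
    (hconv : Convex ℝ K) (hint : (interior K).Nonempty) :
    ∃ F : EuclideanSpace ℝ (Fin m) → EuclideanSpace ℝ (Fin (m + 1)),
      Continuous F ∧ (∀ y ∈ K, F y ∈ sphere 0 1) ∧ InjOn F (interior K) ∧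
      (∀ y ∈ frontier K, ∀ z ∈ frontier K, F y = F z) ∧
      ∀ y ∈ frontier K, ∀ z ∈ interior K, F y ≠ F z := by
  obtain ⟨e, hi, hc, hf⟩ :=
    exists_homeomorph_image_interior_closure_frontier_eq_unitBall hconv hint hK.isBounded
  rw [hK.isClosed.closure_eq] at hc
  have hmem {s t : Set (EuclideanSpace ℝ (Fin m))} (h : e '' s = t) {y} (hy : y ∈ s) : e y ∈ t :=
    h ▸ mem_image_of_mem e hy
  refine ⟨fun y ↦ ballToSphere (e y), continuous_ballToSphere.comp e.continuous,
    fun y hy ↦ ?_, fun y hy z hz h ↦ e.injective (ballToSphere_injOn (hmem hi hy) (hmem hi hz) h),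
    fun y hy z hz ↦ ballToSphere_eq_of_mem_sphere (hmem hf hy) (hmem hf hz), fun y hy z hz h ↦ ?_⟩
  · exact mem_sphere_zero_iff_norm.2
      (norm_ballToSphere (mem_closedBall_zero_iff.1 (hmem hc hy)))
  · have hy' := mem_sphere_zero_iff_norm.1 (hmem hf hy)
    have hz' := mem_ball_zero_iff.1 (hmem hi hz)
    exact hz'.ne (norm_eq_of_ballToSphere_eq h ▸ hy')

/-- The point of the segment from `a` to `b` at parameter `v 0 / ‖v‖ ∈ [-1, 1]`, measured from the
midpoint in units of half the segment. -/
noncomputable def segmentPoint (v : EuclideanSpace ℝ (Fin (m + 1)))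
    (a b : EuclideanSpace ℝ (Fin m)) : EuclideanSpace ℝ (Fin m) :=
  (1 / 2 * (1 - v 0 / ‖v‖)) • a + (1 / 2 * (1 + v 0 / ‖v‖)) • b

/-- `y` is the point with coordinate `v 0 / ‖v‖ ∈ [-1, 1]` on a maximal chord of `K` in the
direction formed by the remaining coordinates of `v`. -/
def IsChordPoint (K : Set (EuclideanSpace ℝ (Fin m))) (v : EuclideanSpace ℝ (Fin (m + 1)))
    (y : EuclideanSpace ℝ (Fin m)) : Prop :=
  ∃ a b, IsMaximalChord K (euclideanTail v) a b ∧ segmentPoint v a b = y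

variable {K : Set (EuclideanSpace ℝ (Fin m))} {v w : EuclideanSpace ℝ (Fin (m + 1))}
  {a b y z : EuclideanSpace ℝ (Fin m)}

lemma abs_div_norm_le_one (v : EuclideanSpace ℝ (Fin (m + 1))) : |v 0 / ‖v‖| ≤ 1 := by
  rw [abs_div, abs_norm]
  exact div_le_one_of_le₀ (PiLp.norm_apply_le v 0) (norm_nonneg _)

lemma abs_div_norm_lt_one (hv : euclideanTail v ≠ 0) : |v 0 / ‖v‖| < 1 := by
  have hpos : 0 < ‖euclideanTail v‖ := norm_pos_iff.2 hv
  have hsq := norm_sq_eq_sq_add_norm_tail_sq v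
  have hlt : |v 0| < ‖v‖ := abs_lt_of_sq_lt_sq (by nlinarith) (norm_nonneg _)
  rw [abs_div, abs_norm]
  exact (div_lt_one ((abs_nonneg _).trans_lt hlt)).2 hlt

lemma segmentPoint_mem (hconv : Convex ℝ K) (ha : a ∈ K) (hb : b ∈ K) :
    segmentPoint v a b ∈ K := by
  have h := abs_le.1 (abs_div_norm_le_one v)
  exact hconv ha hb (by linarith) (by linarith) (by ring)

lemma eq_of_euclideanTail_eq (hv : euclideanTail v ≠ 0)
    (ht : euclideanTail v = euclideanTail w) (h : v 0 / ‖v‖ = w 0 / ‖w‖) : v = w := by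
  have hv0 : ‖v‖ ≠ 0 := fun h0 ↦ hv (by rw [norm_eq_zero.1 h0]; rfl)
  have hw0 : ‖w‖ ≠ 0 := fun h0 ↦ hv (by rw [ht, norm_eq_zero.1 h0]; rfl)
  have hlt := sq_lt_one_iff_abs_lt_one _ |>.2 (abs_div_norm_lt_one hv)
  have hsv := norm_sq_eq_sq_add_norm_tail_sq v
  have hsw := norm_sq_eq_sq_add_norm_tail_sq w
  have hv1 : v 0 = v 0 / ‖v‖ * ‖v‖ := (div_mul_cancel₀ _ hv0).symm
  have hw1 : w 0 = v 0 / ‖v‖ * ‖w‖ := by rw [h, div_mul_cancel₀ _ hw0]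
  set τ := v 0 / ‖v‖
  rw [hv1] at hsv
  rw [hw1, ← ht] at hsw
  have hn : ‖v‖ ^ 2 = ‖w‖ ^ 2 := by
    refine mul_left_cancel₀ (sub_pos.2 hlt).ne' ?_
    linear_combination hsv - hsw
  have hn' := (sq_eq_sq₀ (norm_nonneg v) (norm_nonneg w)).1 hn
  exact euclidean_ext (by rw [hv1, hw1, hn']) ht

namespace IsChordPoint

lemma mem (h : IsChordPoint K v y) (hK : IsCompact K) (hconv : Convex ℝ K) : y ∈ K := by
  obtain ⟨a, b, hab, rfl⟩ := h
  exact segmentPoint_mem hconv (hab.left_mem hK) (hab.right_mem hK)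

lemma smul (h : IsChordPoint K v y) {r : ℝ} (hr : r ≠ 0) : IsChordPoint K (r • v) y := by
  obtain ⟨a, b, hab, rfl⟩ := h
  rcases hr.lt_or_gt with hr | hr
  · refine ⟨b, a, hab.smul_of_neg hr, ?_⟩
    have : (r • v) 0 / ‖r • v‖ = -(v 0 / ‖v‖) := by
      rw [norm_smul, Real.norm_eq_abs, abs_of_neg hr, PiLp.smul_apply, smul_eq_mul, neg_mul,
        div_neg, mul_div_mul_left _ _ hr.ne]
    rw [segmentPoint, segmentPoint, this]
    module
  · refine ⟨a, b, hab.smul_of_pos hr, ?_⟩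
    have : (r • v) 0 / ‖r • v‖ = v 0 / ‖v‖ := by
      rw [norm_smul, Real.norm_eq_abs, abs_of_pos hr, PiLp.smul_apply, smul_eq_mul,
        mul_div_mul_left _ _ hr.ne']
    rw [segmentPoint, segmentPoint, this]

lemma eq_of_eq (h : IsChordPoint K v y) (h' : IsChordPoint K v z) (hK : IsCompact K)
    (hint : (interior K).Nonempty) (hstrict : StrictConvex ℝ K) (hv : euclideanTail v ≠ 0) :
    y = z := by
  obtain ⟨a, b, hab, rfl⟩ := h
  obtain ⟨a', b', hab', rfl⟩ := h'
  obtain ⟨rfl, rfl⟩ := hab.eq_and_eq hab' hK hint hstrict hv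
  rfl

lemma mem_frontier (h : IsChordPoint K v y) (hv : v ≠ 0) (ht : euclideanTail v = 0) :
    y ∈ frontier K := by
  obtain ⟨a, b, hab, rfl⟩ := h
  have hsq := norm_sq_eq_sq_add_norm_tail_sq v
  rw [ht, norm_zero, zero_pow two_ne_zero, add_zero] at hsq
  have hv' : ‖v‖ ≠ 0 := norm_ne_zero_iff.2 hv
  rcases sq_eq_sq_iff_eq_or_eq_neg.1 hsq.symm with h0 | h0
  · rw [segmentPoint, h0, div_self hv']
    norm_num
    exact hab.2.1
  · rw [segmentPoint, h0, neg_div, div_self hv']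
    norm_num
    exact hab.1

lemma mem_interior (h : IsChordPoint K v y) (hK : IsCompact K) (hstrict : StrictConvex ℝ K)
    (hv : euclideanTail v ≠ 0) : y ∈ interior K := by
  obtain ⟨a, b, hab, rfl⟩ := h
  have hlt := abs_lt.1 (abs_div_norm_lt_one hv)
  exact hstrict (hab.left_mem hK) (hab.right_mem hK) (hab.ne hv) (by linarith) (by linarith)
    (by ring)

lemma eq_of_euclideanTail_eq (h : IsChordPoint K v y) (h' : IsChordPoint K w y)
    (hK : IsCompact K) (hint : (interior K).Nonempty) (hstrict : StrictConvex ℝ K)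
    (hv : euclideanTail v ≠ 0) (ht : euclideanTail v = euclideanTail w) : v = w := by
  obtain ⟨a, b, hab, rfl⟩ := h
  obtain ⟨a', b', hab', hy⟩ := h'
  obtain ⟨rfl, rfl⟩ := hab.eq_and_eq (ht ▸ hab') hK hint hstrict hv
  refine _root_.eq_of_euclideanTail_eq hv ht ?_
  have hsub : (v 0 / ‖v‖ - w 0 / ‖w‖) • (b - a) = 0 := by
    have : (v 0 / ‖v‖ - w 0 / ‖w‖) • (b - a)
        = (2 : ℝ) • (segmentPoint v a b - segmentPoint w a b) := by
      rw [segmentPoint, segmentPoint]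
      module
    rw [this, hy, sub_self, smul_zero]
  exact sub_eq_zero.1 ((smul_eq_zero.1 hsub).resolve_right (sub_ne_zero.2 (hab.ne hv).symm))

lemma isAffineDiameter (h : IsChordPoint K v y) (hK : IsCompact K)
    (hint : (interior K).Nonempty) (hv : euclideanTail v ≠ 0) :
    IsAffineDiameter K (euclideanTail v) {p | ∃ t : ℝ, p = y + t • euclideanTail v} := by
  obtain ⟨a, b, hab, rfl⟩ := h
  refine ⟨⟨_, rfl⟩, ?_⟩
  rintro _ ⟨p, rfl⟩
  set u := euclideanTail v
  have hba : b - a = (gauge (K - K) u)⁻¹ • u :=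
    (eq_inv_smul_iff₀ (gauge_sub_self_pos hK hint hv).ne').2 hab.2.2
  have hmem {x} {t : ℝ} (hx : x ∈ K) (hxt : x = segmentPoint v a b + t • (b - a)) :
      x ∈ K ∩ {p | ∃ t : ℝ, p = segmentPoint v a b + t • u} :=
    ⟨hx, t * (gauge (K - K) u)⁻¹, by rw [mul_smul, ← hba]; exact hxt⟩
  refine (diam_le_of_forall_dist_le dist_nonneg ?_).trans
    (dist_le_diam_of_mem (hK.isBounded.subset inter_subset_left)
      (hmem (t := -(1 / 2 * (1 + v 0 / ‖v‖))) (hab.left_mem hK) ?_)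
      (hmem (t := 1 / 2 * (1 - v 0 / ‖v‖)) (hab.right_mem hK) ?_))
  · rintro x ⟨hx, t, hxt⟩ z ⟨hz, s, hzs⟩
    exact hab.dist_le hx hz (t := t - s) (by rw [hxt, hzs]; module)
  · rw [segmentPoint]
    module
  · rw [segmentPoint]
    module

end IsChordPoint

lemma exists_isChordPoint (hm : 1 ≤ m) (hK : IsCompact K) (hconv : Convex ℝ K)
    (hint : (interior K).Nonempty) (v : EuclideanSpace ℝ (Fin (m + 1))) :
    ∃ y, IsChordPoint K v y := by
  have : Nonempty (Fin m) := ⟨⟨0, hm⟩⟩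
  obtain ⟨a, b, hab⟩ := exists_isMaximalChord hK hconv hint (euclideanTail v)
  exact ⟨_, a, b, hab, rfl⟩

/-- A function of a nonzero vector `v` whose value is that of a continuous `F` at all chord points
of `v` is continuous. -/
lemma continuous_of_isChordPoint (hK : IsCompact K) (hconv : Convex ℝ K)
    (hint : (interior K).Nonempty) {X : Type*} [TopologicalSpace X]
    {F : EuclideanSpace ℝ (Fin m) → X} (hF : Continuous F)
    {g : {v : EuclideanSpace ℝ (Fin (m + 1)) // v ≠ 0} → X}
    (hex : ∀ v : EuclideanSpace ℝ (Fin (m + 1)), ∃ y, IsChordPoint K v y)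
    (hg : ∀ v y, IsChordPoint K v.1 y → g v = F y) : Continuous g := by
  refine continuous_iff_isClosed.2 fun C hC ↦ ?_
  have : CompactSpace (frontier K) :=
    isCompact_iff_compactSpace.1 (hK.of_isClosed_subset isClosed_frontier
      hK.isClosed.frontier_subset)
  let S : Set ({v : EuclideanSpace ℝ (Fin (m + 1)) // v ≠ 0} × (frontier K × frontier K)) :=
    {p | gauge (K - K) (euclideanTail p.1.1) • (p.2.2.1 - p.2.1.1) = euclideanTail p.1.1 ∧
      F (segmentPoint p.1.1 p.2.1.1 p.2.2.1) ∈ C}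
  have hgauge : Continuous (gauge (K - K)) :=
    continuous_gauge (hconv.sub hconv) (sub_self_mem_nhds_zero hint)
  have hpt : Continuous fun p : {v : EuclideanSpace ℝ (Fin (m + 1)) // v ≠ 0} ×
      (frontier K × frontier K) ↦ segmentPoint p.1.1 p.2.1.1 p.2.2.1 := by
    have hdiv : Continuous fun p : {v : EuclideanSpace ℝ (Fin (m + 1)) // v ≠ 0} ×
        (frontier K × frontier K) ↦ p.1.1 0 / ‖p.1.1‖ :=
      Continuous.div (by fun_prop) (by fun_prop) fun p ↦ norm_ne_zero_iff.2 p.1.2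
    unfold segmentPoint
    fun_prop
  have hS : IsClosed S :=
    (isClosed_eq (by fun_prop) (by fun_prop)).inter (hC.preimage (hF.comp hpt))
  convert isClosedMap_fst_of_compactSpace S hS
  ext v
  constructor
  · intro hv
    obtain ⟨y, a, b, hab, rfl⟩ := hex v.1
    refine ⟨(v, ⟨a, hab.1⟩, ⟨b, hab.2.1⟩), ⟨hab.2.2, ?_⟩, rfl⟩
    rw [← hg v _ ⟨a, b, hab, rfl⟩]
    exact hv
  · rintro ⟨⟨v, a, b⟩, ⟨hab, hC'⟩, rfl⟩
    rw [mem_preimage, hg v _ ⟨a, b, ⟨a.2, b.2, hab⟩, rfl⟩]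
    exact hC'

end ChordPoint

/-- For a strictly convex body `K ⊆ ℝ^m` there is a continuous map
`f : ℝP^m → S^m` such that any `k`-multiplicity of `f` yields `k` pairwise distinct
affine diameters of `K` meeting at a common point of the interior of `K`. -/
theorem exists_map_affineDiameters_of_strictConvex
    (m : ℕ) (hm : 1 ≤ m) (K : Set (EuclideanSpace ℝ (Fin m)))
    (hKcomp : IsCompact K) (hKconv : Convex ℝ K) (hKint : (interior K).Nonempty)
    (hKstrict : StrictConvex ℝ K) :
    ∃ f : Projectivization ℝ (EuclideanSpace ℝ (Fin (m + 1))) →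
        Metric.sphere (0 : EuclideanSpace ℝ (Fin (m + 1))) 1,
      Continuous f ∧
        ∀ k : ℕ, 2 ≤ k →
          (∃ x : Fin k → Projectivization ℝ (EuclideanSpace ℝ (Fin (m + 1))),
            Function.Injective x ∧ ∀ i j, f (x i) = f (x j)) →
          ∃ L : Fin k → Set (EuclideanSpace ℝ (Fin m)),
            Function.Injective L ∧
              (∀ i, ∃ w : EuclideanSpace ℝ (Fin m), w ≠ 0 ∧ IsAffineDiameter K w (L i)) ∧
              ∃ z, z ∈ interior K ∧ ∀ i, z ∈ L i := by
  obtain ⟨F, hF, hFs, hFi, hFf, hFfi⟩ := exists_wrapping hKcomp hKconv hKint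
  have hex := exists_isChordPoint hm hKcomp hKconv hKint
  have huniq {v y z} (hv : v ≠ 0) (hy : IsChordPoint K v y) (hz : IsChordPoint K v z) :
      F y = F z := by
    by_cases ht : euclideanTail v = 0
    · exact hFf _ (hy.mem_frontier hv ht) _ (hz.mem_frontier hv ht)
    · rw [hy.eq_of_eq hz hKcomp hKint hKstrict ht]
  choose c hc using hex
  let g : {v : EuclideanSpace ℝ (Fin (m + 1)) // v ≠ 0} →
      Metric.sphere (0 : EuclideanSpace ℝ (Fin (m + 1))) 1 :=
    fun v ↦ ⟨F (c v), hFs _ ((hc v).mem hKcomp hKconv)⟩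
  have hg : Continuous g :=
    (continuous_of_isChordPoint hKcomp hKconv hKint hF (fun v ↦ ⟨c v, hc v⟩)
      fun v y hy ↦ huniq v.2 (hc v) hy).subtype_mk _
  have hlift : ∀ (v w : {v : EuclideanSpace ℝ (Fin (m + 1)) // v ≠ 0}) (t : ℝ),
      v.1 = t • w.1 → g v = g w := by
    intro v w t h
    have ht : t ≠ 0 := by
      rintro rfl
      exact v.2 (by rw [h, zero_smul])
    exact Subtype.ext (huniq v.2 (hc v) (h ▸ (hc w).smul ht))
  refine ⟨Projectivization.lift g hlift, hg.quotient_lift _, ?_⟩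
  rintro k hk ⟨x, hx, hfx⟩
  have hval : ∀ i j, F (c (x i).rep) = F (c (x j).rep) := by
    intro i j
    have h := hfx i j
    rw [← (x i).mk_rep, ← (x j).mk_rep] at h
    exact congrArg Subtype.val h
  have heq : ∀ i j, ∀ t : ℝ, (x i).rep = t • (x j).rep → i = j := by
    intro i j t h
    refine hx ?_
    rw [← (x i).mk_rep, ← (x j).mk_rep]
    exact (Projectivization.mk_eq_mk_iff' ℝ _ _ (x i).rep_nonzero (x j).rep_nonzero).2 ⟨t, h.symm⟩
  have htail : ∀ i, euclideanTail (x i).rep ≠ 0 := by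
    intro i hi
    have : Nontrivial (Fin k) := Fin.nontrivial_iff_two_le.2 hk
    obtain ⟨j, hji⟩ := exists_ne i
    have hif := (hc (x i).rep).mem_frontier (x i).rep_nonzero hi
    by_cases hj : euclideanTail (x j).rep = 0
    · have hi0 : (x i).rep 0 ≠ 0 := fun h0 ↦
        (x i).rep_nonzero (euclidean_ext h0 hi)
      refine hji (heq j i ((x j).rep 0 / (x i).rep 0) (euclidean_ext ?_ ?_))
      · rw [PiLp.smul_apply, smul_eq_mul, div_mul_cancel₀ _ hi0]
      · rw [euclideanTail_smul, hi, hj, smul_zero]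
    · exact hFfi _ hif _ ((hc (x j).rep).mem_interior hKcomp hKstrict hj) (hval i j)
  have hint : ∀ i, c (x i).rep ∈ interior K := fun i ↦
    (hc (x i).rep).mem_interior hKcomp hKstrict (htail i)
  have hzero : 0 < k := by omega
  set z := c (x ⟨0, hzero⟩).rep with hz
  have hcz : ∀ i, IsChordPoint K (x i).rep z := by
    intro i
    rw [hz, ← hFi (hint i) (hint _) (hval i ⟨0, hzero⟩)]
    exact hc (x i).rep
  refine ⟨fun i ↦ {p | ∃ t : ℝ, p = z + t • euclideanTail (x i).rep}, ?_,
    fun i ↦ ⟨_, htail i, (hcz i).isAffineDiameter hKcomp hKint (htail i)⟩, z, hint _,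
    fun i ↦ ⟨0, by simp⟩⟩
  intro i j hij
  have hmem : z + euclideanTail (x i).rep ∈
      {p | ∃ t : ℝ, p = z + t • euclideanTail (x j).rep} := by
    exact hij.subset ⟨1, by rw [one_smul]⟩
  obtain ⟨t, ht⟩ := hmem
  have ht' : euclideanTail (x i).rep = t • euclideanTail (x j).rep := add_left_cancel ht
  have ht0 : t ≠ 0 := by
    rintro rfl
    exact htail i (by rw [ht', zero_smul])
  exact heq i j t ((hcz i).eq_of_euclideanTail_eq ((hcz j).smul ht0) hKcomp hKint hKstrict
    (htail i) ht')
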